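/- arXiv:1201.2733 — 6 statements merged into one kernel-verified Lean document; each statement's English description precedes it below -/
import Mathlib

section
/- Let K ≥ 1 be an integer and let A be a real m × n matrix satisfying the restricted isometry property of order K+1 with a constant δ satisfying δ < 1/(√K + 1). Let x ∈ ℝⁿ be a nonzero vector whose support S satisfies |S| ≤ K. Then for every index j ∉ S, one has max_{i ∈ S} |⟨A e_i, A x⟩| > |⟨A e_j, A x⟩|. -/
open scoped BigOperators

/-- Euclidean dot product on `Fin m → ℝ`. -/
def dotp {m : ℕ} (u v : Fin m → ℝ) : ℝ := ∑ i, u i * v i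

/-- `A` satisfies the restricted isometry property of order `s` with constant `δ`:
`(1-δ)‖x‖₂² ≤ ‖Ax‖₂² ≤ (1+δ)‖x‖₂²` for all vectors `x` with at most `s` nonzero entries. -/
def RIP {m n : ℕ} (A : Matrix (Fin m) (Fin n) ℝ) (s : ℕ) (δ : ℝ) : Prop :=
  ∀ x : Fin n → ℝ, {i | x i ≠ 0}.ncard ≤ s →
    (1 - δ) * (∑ i, x i ^ 2) ≤ (∑ j, (A.mulVec x) j ^ 2) ∧
      (∑ j, (A.mulVec x) j ^ 2) ≤ (1 + δ) * (∑ i, x i ^ 2)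

theorem dotp_mulVec_single {m n : ℕ} (A : Matrix (Fin m) (Fin n) ℝ) (i : Fin n)
    (v : Fin m → ℝ) : dotp (A.mulVec (Pi.single i 1)) v = ∑ k, A k i * v k := by
  simp [dotp]

theorem sum_mul_dotp_mulVec_single {m n : ℕ} (A : Matrix (Fin m) (Fin n) ℝ)
    (x : Fin n → ℝ) :
    ∑ i, x i * dotp (A.mulVec (Pi.single i 1)) (A.mulVec x) = ∑ k, (A.mulVec x) k ^ 2 := by
  simp only [dotp_mulVec_single, Finset.mul_sum]
  rw [Finset.sum_comm]
  refine Finset.sum_congr rfl fun k _ => ?_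
  rw [sq]
  nth_rewrite 2 [Matrix.mulVec]
  rw [dotProduct, Finset.sum_mul]
  exact Finset.sum_congr rfl fun i _ => by ring

theorem sum_mulVec_single_add_sq {m n : ℕ} (A : Matrix (Fin m) (Fin n) ℝ) (x : Fin n → ℝ)
    (j : Fin n) (t : ℝ) :
    ∑ k, (A.mulVec (t • Pi.single j 1 + x)) k ^ 2 =
      t ^ 2 * ∑ k, (A.mulVec (Pi.single j 1)) k ^ 2 +
        2 * t * dotp (A.mulVec (Pi.single j 1)) (A.mulVec x) + ∑ k, (A.mulVec x) k ^ 2 := by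
  rw [Matrix.mulVec_add, Matrix.mulVec_smul, dotp, Finset.mul_sum, Finset.mul_sum,
    ← Finset.sum_add_distrib, ← Finset.sum_add_distrib]
  refine Finset.sum_congr rfl fun k _ => ?_
  simp only [Pi.add_apply, Pi.smul_apply, smul_eq_mul]
  ring

theorem sum_single_add_sq {n : ℕ} {x : Fin n → ℝ} {j : Fin n} (hj : x j = 0) (t : ℝ) :
    ∑ i, (t • Pi.single j 1 + x : Fin n → ℝ) i ^ 2 = t ^ 2 + ∑ i, x i ^ 2 := by
  have h : ∀ i, (t • Pi.single j 1 + x : Fin n → ℝ) i ^ 2 =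
      (if i = j then t ^ 2 else 0) + x i ^ 2 := by
    intro i
    by_cases hij : i = j
    · subst hij; simp [hj]
    · simp [hij]
  rw [Finset.sum_congr rfl fun i _ => h i, Finset.sum_add_distrib]
  simp

theorem ncard_support_single_add_le {n K : ℕ} {x : Fin n → ℝ}
    (hsupp : {i | x i ≠ 0}.ncard ≤ K) (j : Fin n) (t : ℝ) :
    {i | (t • Pi.single j 1 + x : Fin n → ℝ) i ≠ 0}.ncard ≤ K + 1 := by
  have hsub : {i | (t • Pi.single j 1 + x : Fin n → ℝ) i ≠ 0} ⊆ insert j {i | x i ≠ 0} := by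
    intro i hi
    by_cases hij : i = j
    · exact Or.inl hij
    · right
      simpa [hij] using hi
  have := Set.ncard_le_ncard hsub (Set.toFinite _)
  have := Set.ncard_insert_le j {i | x i ≠ 0}
  omega

/-- Under RIP of order `K + 1`, a column outside the support of a `K`-sparse `x` is nearly
orthogonal to `A x`. -/
theorem RIP.abs_dotp_le {m n K : ℕ} {A : Matrix (Fin m) (Fin n) ℝ} {δ : ℝ}
    (hRIP : RIP A (K + 1) δ) {x : Fin n → ℝ} (hx : 0 < ∑ i, x i ^ 2)
    (hsupp : {i | x i ≠ 0}.ncard ≤ K) {j : Fin n} (hj : x j = 0) :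
    |dotp (A.mulVec (Pi.single j 1)) (A.mulVec x)| ≤ δ * √(∑ i, x i ^ 2) := by
  have ht : 0 < √(∑ i, x i ^ 2) := Real.sqrt_pos.2 hx
  have hsq : √(∑ i, x i ^ 2) ^ 2 = ∑ i, x i ^ 2 := Real.sq_sqrt hx.le
  set t := √(∑ i, x i ^ 2)
  have hp := hRIP _ (ncard_support_single_add_le hsupp j t)
  have hm := hRIP _ (ncard_support_single_add_le hsupp j (-t))
  rw [sum_mulVec_single_add_sq, sum_single_add_sq hj, ← hsq] at hp hm
  rw [abs_le]
  constructor
  · refine le_of_mul_le_mul_left ?_ ht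
    linarith [hp.1, hm.2]
  · refine le_of_mul_le_mul_left ?_ ht
    linarith [hp.2, hm.1]

theorem sum_abs_le_sqrt_mul_sqrt {n K : ℕ} {x : Fin n → ℝ}
    (hsupp : {i | x i ≠ 0}.ncard ≤ K) :
    ∑ i, |x i| ≤ √K * √(∑ i, x i ^ 2) := by
  classical
  rw [← Real.sqrt_mul (Nat.cast_nonneg K)]
  refine Real.le_sqrt_of_sq_le ?_
  let S := Finset.univ.filter fun i => x i ≠ 0
  have hS : (S.card : ℝ) ≤ K := by
    rw [Set.ncard_eq_toFinset_card'] at hsupp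
    simpa [S] using hsupp
  have h1 : ∑ i, |x i| = ∑ i ∈ S, |x i| := by
    refine (Finset.sum_subset (Finset.subset_univ S) fun i _ hi => ?_).symm
    simpa [S] using hi
  have h2 : ∑ i ∈ S, |x i| ^ 2 ≤ ∑ i, x i ^ 2 := by
    simp only [sq_abs]
    exact Finset.sum_le_univ_sum_of_nonneg fun i => sq_nonneg _
  rw [h1]
  calc (∑ i ∈ S, |x i|) ^ 2 ≤ S.card * ∑ i ∈ S, |x i| ^ 2 := sq_sum_le_card_mul_sum_sq
    _ ≤ K * ∑ i, x i ^ 2 := by gcongr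

theorem le_biSup_of_finite {ι : Type*} [Finite ι] (p : ι → Prop) (f : ι → ℝ) {i : ι}
    (hi : p i) : f i ≤ ⨆ (k) (_ : p k), f k := by
  refine le_ciSup_of_le (Set.finite_range _).bddAbove i ?_
  rw [ciSup_pos hi]

/-- under RIP of order `K+1` with `δ < 1/(√K + 1)`, the largest correlation
`|⟨A e_i, A x⟩|` over indices `i` in the support of the `K`-sparse nonzero vector `x`
strictly exceeds `|⟨A e_j, A x⟩|` for every `j` outside the support. -/
theorem stmt0 {m n K : ℕ} (hK : 1 ≤ K) (A : Matrix (Fin m) (Fin n) ℝ) (δ : ℝ)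
    (hRIP : RIP A (K + 1) δ) (hδ : δ < 1 / (Real.sqrt K + 1))
    (x : Fin n → ℝ) (hx : x ≠ 0) (hsupp : {i | x i ≠ 0}.ncard ≤ K) :
    ∀ j : Fin n, x j = 0 →
      |dotp (A.mulVec (Pi.single j 1)) (A.mulVec x)| <
        ⨆ i ∈ {i : Fin n | x i ≠ 0}, |dotp (A.mulVec (Pi.single i 1)) (A.mulVec x)| := by
  intro j hj
  have hpos : 0 < ∑ i, x i ^ 2 := by
    obtain ⟨i, hi⟩ := Function.ne_iff.1 hx
    exact Finset.sum_pos' (fun i _ => sq_nonneg _) ⟨i, Finset.mem_univ i, sq_pos_of_ne_zero hi⟩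
  have hcol := hRIP.abs_dotp_le hpos hsupp hj
  have hlow := (hRIP x (by omega)).1
  have hl1 := sum_abs_le_sqrt_mul_sqrt hsupp
  have hsq : √(∑ i, x i ^ 2) ^ 2 = ∑ i, x i ^ 2 := Real.sq_sqrt hpos.le
  set t := √(∑ i, x i ^ 2)
  have hle : ∀ i, x i ≠ 0 → |dotp (A.mulVec (Pi.single i 1)) (A.mulVec x)| ≤
      ⨆ i ∈ {i : Fin n | x i ≠ 0}, |dotp (A.mulVec (Pi.single i 1)) (A.mulVec x)| :=
    fun i hi => le_biSup_of_finite (fun i => i ∈ {i : Fin n | x i ≠ 0})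
      (fun i => |dotp (A.mulVec (Pi.single i 1)) (A.mulVec x)|) hi
  set M := ⨆ i ∈ {i : Fin n | x i ≠ 0}, |dotp (A.mulVec (Pi.single i 1)) (A.mulVec x)|
  have hup : ∑ k, (A.mulVec x) k ^ 2 ≤ M * ∑ i, |x i| := by
    rw [← sum_mul_dotp_mulVec_single, Finset.mul_sum]
    refine Finset.sum_le_sum fun i _ => ?_
    by_cases hi : x i = 0
    · simp [hi]
    · refine (le_abs_self _).trans ?_
      rw [abs_mul, mul_comm]
      exact mul_le_mul_of_nonneg_right (hle i hi) (abs_nonneg _)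
  by_contra! hM
  have hδt : M ≤ δ * t := hM.trans hcol
  have hδt0 : 0 ≤ δ * t := (abs_nonneg _).trans hcol
  have hmul : M * ∑ i, |x i| ≤ δ * t * (√K * t) :=
    mul_le_mul hδt hl1 (Finset.sum_nonneg fun i _ => abs_nonneg _) hδt0
  rw [lt_div_iff₀ (by positivity)] at hδ
  rw [← hsq] at hpos hlow
  linarith [mul_pos (sub_pos.2 hδ) hpos]
end

section
/- Let K ≥ 1 be an integer and let A be a real m × n matrix satisfying the restricted isometry property of order K+1 with constant δ. Let x ∈ ℝⁿ be a nonzero vector whose support S satisfies |S| ≤ K. Then (1−δ)‖x‖₂ / √K ≤ max_{i ∈ S} |⟨A e_i, A x⟩|. -/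
open scoped BigOperators

/-- `‖Ax‖² = ∑ᵢ xᵢ ⟨A eᵢ, A x⟩`. -/
lemma sum_mulVec_sq_eq_sum_mul_dotp {m n : ℕ} (A : Matrix (Fin m) (Fin n) ℝ) (x : Fin n → ℝ) :
    ∑ j, (A.mulVec x) j ^ 2 =
      ∑ i, x i * dotp (A.mulVec (Pi.single i 1)) (A.mulVec x) := by
  simp only [dotp, Matrix.mulVec_single_one, Matrix.col_apply, Finset.mul_sum]
  rw [Finset.sum_comm]
  refine Finset.sum_congr rfl fun j _ => ?_
  rw [sq]
  nth_rewrite 1 [Matrix.mulVec, dotProduct]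
  rw [Finset.sum_mul]
  exact Finset.sum_congr rfl fun i _ => by ring

/-- A `K`-sparse vector satisfies `‖x‖₁ ≤ √K ‖x‖₂`. -/
lemma sum_abs_le_sqrt_mul_sqrt_of_sparse {n K : ℕ} (x : Fin n → ℝ)
    (hsupp : {i | x i ≠ 0}.ncard ≤ K) :
    ∑ i, |x i| ≤ Real.sqrt K * Real.sqrt (∑ i, x i ^ 2) := by
  classical
  set S : Finset (Fin n) := Finset.univ.filter fun i => x i ≠ 0 with hS
  have hcard : S.card ≤ K := by
    rw [← Set.ncard_coe_finset]
    simpa [hS] using hsupp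
  have hsum : ∑ i, |x i| = ∑ i ∈ S, |x i| :=
    (Finset.sum_subset S.subset_univ fun i _ hi => by simpa [hS] using hi).symm
  rw [← Real.sqrt_mul (Nat.cast_nonneg K), hsum]
  refine Real.le_sqrt_of_sq_le ?_
  calc (∑ i ∈ S, |x i|) ^ 2 ≤ S.card * ∑ i ∈ S, |x i| ^ 2 := sq_sum_le_card_mul_sum_sq
    _ = S.card * ∑ i ∈ S, x i ^ 2 := by simp only [sq_abs]
    _ ≤ K * ∑ i, x i ^ 2 := by
      gcongr
      exact S.subset_univ

/-- under RIP of order `K+1` with constant `δ`, for a nonzero `K`-sparse `x`,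
`(1-δ)‖x‖₂/√K ≤ max_{i ∈ supp x} |⟨A e_i, A x⟩|`. -/
theorem stmt1 {m n K : ℕ} (hK : 1 ≤ K) (A : Matrix (Fin m) (Fin n) ℝ) (δ : ℝ)
    (hRIP : RIP A (K + 1) δ)
    (x : Fin n → ℝ) (hx : x ≠ 0) (hsupp : {i | x i ≠ 0}.ncard ≤ K) :
    (1 - δ) * Real.sqrt (∑ i, x i ^ 2) / Real.sqrt K ≤
      ⨆ i ∈ {i : Fin n | x i ≠ 0}, |dotp (A.mulVec (Pi.single i 1)) (A.mulVec x)| := by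
  set f : Fin n → ℝ := fun i => |dotp (A.mulVec (Pi.single i 1)) (A.mulVec x)|
  set M : ℝ := ⨆ i ∈ {i : Fin n | x i ≠ 0}, f i
  have hM : 0 ≤ M := Real.iSup_nonneg fun i => Real.iSup_nonneg fun _ => abs_nonneg _
  have hle : ∀ i, x i ≠ 0 → f i ≤ M := fun i hi =>
    (ciSup_pos (f := fun _ => f i) (show i ∈ {i : Fin n | x i ≠ 0} from hi)).symm.le.trans
      (le_ciSup (f := fun i => ⨆ _ : i ∈ {i : Fin n | x i ≠ 0}, f i)
        (Set.finite_range _).bddAbove i)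
  have hpos : 0 < Real.sqrt (∑ i, x i ^ 2) := by
    obtain ⟨i, hi⟩ := Function.ne_iff.mp hx
    exact Real.sqrt_pos.mpr (Finset.sum_pos' (fun j _ => sq_nonneg (x j))
      ⟨i, Finset.mem_univ i, by have : x i ≠ 0 := hi; positivity⟩)
  have hKpos : 0 < Real.sqrt K := Real.sqrt_pos.mpr (by exact_mod_cast hK)
  rw [div_le_iff₀ hKpos]
  refine le_of_mul_le_mul_right ?_ hpos
  calc (1 - δ) * Real.sqrt (∑ i, x i ^ 2) * Real.sqrt (∑ i, x i ^ 2)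
      = (1 - δ) * ∑ i, x i ^ 2 := by
        rw [mul_assoc, Real.mul_self_sqrt (Finset.sum_nonneg fun i _ => sq_nonneg (x i))]
    _ ≤ ∑ j, (A.mulVec x) j ^ 2 := (hRIP x (hsupp.trans K.le_succ)).1
    _ = ∑ i, x i * dotp (A.mulVec (Pi.single i 1)) (A.mulVec x) :=
        sum_mulVec_sq_eq_sum_mul_dotp A x
    _ ≤ ∑ i, M * |x i| := Finset.sum_le_sum fun i _ => by
        rcases eq_or_ne (x i) 0 with hi | hi
        · simp [hi]
        · calc _ ≤ |x i| * f i := (le_abs_self _).trans (abs_mul _ _).le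
            _ ≤ |x i| * M := by gcongr; exact hle i hi
            _ = M * |x i| := mul_comm _ _
    _ = M * ∑ i, |x i| := (Finset.mul_sum _ _ _).symm
    _ ≤ M * (Real.sqrt K * Real.sqrt (∑ i, x i ^ 2)) := by
        gcongr
        exact sum_abs_le_sqrt_mul_sqrt_of_sparse x hsupp
    _ = M * Real.sqrt K * Real.sqrt (∑ i, x i ^ 2) := by ring
end

section
/- Let K ≥ 1 be an integer and let A be a real m × n matrix satisfying the restricted isometry property of order K+1 with constant δ. Let x ∈ ℝⁿ be a vector whose support S satisfies |S| ≤ K. Then for every index j ∉ S, |⟨A e_j, A x⟩| ≤ δ ‖x‖₂. -/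
open scoped BigOperators

/-- Expansion of `‖A (t e_j + x)‖²` as a quadratic polynomial in `t`. -/
lemma sum_sq_mulVec_smul_single_add {m n : ℕ} (A : Matrix (Fin m) (Fin n) ℝ) (x : Fin n → ℝ)
    (j : Fin n) (t : ℝ) :
    ∑ i, (A.mulVec (t • Pi.single j 1 + x)) i ^ 2 =
      t ^ 2 * ∑ i, (A.mulVec (Pi.single j 1)) i ^ 2 +
        2 * t * dotp (A.mulVec (Pi.single j 1)) (A.mulVec x) + ∑ i, (A.mulVec x) i ^ 2 := by
  rw [dotp, Finset.mul_sum, Finset.mul_sum, ← Finset.sum_add_distrib, ← Finset.sum_add_distrib]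
  refine Finset.sum_congr rfl fun i _ => ?_
  rw [Matrix.mulVec_add, Matrix.mulVec_smul, Pi.add_apply, Pi.smul_apply, smul_eq_mul]
  ring

/-- Pythagoras for `t e_j + x` when `j` lies outside the support of `x`. -/
lemma sum_sq_smul_single_add {n : ℕ} (x : Fin n → ℝ) {j : Fin n} (hj : x j = 0) (t : ℝ) :
    ∑ i, (t • Pi.single j 1 + x : Fin n → ℝ) i ^ 2 = t ^ 2 + ∑ i, x i ^ 2 := by
  have h : ∀ i, (t • Pi.single j 1 + x : Fin n → ℝ) i ^ 2 =
      (if i = j then t ^ 2 else 0) + x i ^ 2 := by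
    intro i
    by_cases hi : i = j
    · subst hi
      simp [hj]
    · simp [hi]
  simp only [h, Finset.sum_add_distrib, Finset.sum_ite_eq', Finset.mem_univ, if_true]

/-- Adding a multiple of a basis vector enlarges the support by at most one index. -/
lemma ncard_support_smul_single_add_le {n K : ℕ} (x : Fin n → ℝ)
    (hx : {i | x i ≠ 0}.ncard ≤ K) (j : Fin n) (t : ℝ) :
    {i | (t • Pi.single j 1 + x : Fin n → ℝ) i ≠ 0}.ncard ≤ K + 1 := by
  have hsub : {i | (t • Pi.single j 1 + x : Fin n → ℝ) i ≠ 0} ⊆ insert j {i | x i ≠ 0} := by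
    intro i hi
    by_cases hij : i = j
    · exact Or.inl hij
    · exact Or.inr (by simpa [hij] using hi)
  calc _ ≤ (insert j {i | x i ≠ 0}).ncard := Set.ncard_le_ncard hsub (Set.toFinite _)
    _ ≤ {i | x i ≠ 0}.ncard + 1 := Set.ncard_insert_le _ _
    _ ≤ K + 1 := by lia

/-- under RIP of order `K+1` with constant `δ`, for a `K`-sparse `x` and any
index `j` outside the support of `x`, `|⟨A e_j, A x⟩| ≤ δ ‖x‖₂`. -/
theorem stmt2 {m n K : ℕ} (hK : 1 ≤ K) (A : Matrix (Fin m) (Fin n) ℝ) (δ : ℝ)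
    (hRIP : RIP A (K + 1) δ)
    (x : Fin n → ℝ) (hsupp : {i | x i ≠ 0}.ncard ≤ K) :
    ∀ j : Fin n, x j = 0 →
      |dotp (A.mulVec (Pi.single j 1)) (A.mulVec x)| ≤ δ * Real.sqrt (∑ i, x i ^ 2) := by
  intro j hj
  set N := Real.sqrt (∑ i, x i ^ 2)
  have hN0 : 0 ≤ N := Real.sqrt_nonneg _
  have hNsq : ∑ i, x i ^ 2 = N ^ 2 :=
    (Real.sq_sqrt (Finset.sum_nonneg fun i _ => sq_nonneg (x i))).symm
  have key := fun t : ℝ => hRIP _ (ncard_support_smul_single_add_le x hsupp j t)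
  simp only [sum_sq_mulVec_smul_single_add, sum_sq_smul_single_add x hj, hNsq] at key
  obtain ⟨hl, hu⟩ := key N
  obtain ⟨hl', hu'⟩ := key (-N)
  rcases hN0.eq_or_lt with h0 | hpos
  · have hx : x = 0 := by
      rw [← h0, zero_pow two_ne_zero,
        Finset.sum_eq_zero_iff_of_nonneg fun i _ => sq_nonneg (x i)] at hNsq
      exact funext fun i => pow_eq_zero_iff two_ne_zero |>.1 (hNsq i (Finset.mem_univ i))
    simp [← h0, hx, dotp]
  · rw [abs_le]
    constructor <;> refine le_of_mul_le_mul_left ?_ hpos <;> linarith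
end

section
/- Let K ≥ 2 be an integer and let A be the (K+1) × (K+1) real matrix whose first K columns are the first K standard basis vectors of ℝ^{K+1} and whose last column has entries 1/K in the first K coordinates and √((K−1)/K) in the last coordinate. Then the symmetric matrix AᵀA has characteristic polynomial (λ − 1)^{K−1} (λ − (1 − 1/√K)) (λ − (1 + 1/√K)); in particular its eigenvalues are 1 with multiplicity K−1, together with 1 − 1/√K and 1 + 1/√K, each with multiplicity one. -/
open scoped BigOperators
open Polynomial

/-- The `(K+1) × (K+1)` matrix whose first `K` columns are the first `K` standard basis
vectors of `ℝ^{K+1}` and whose last column is `(1/K, …, 1/K, √((K-1)/K))ᵀ`. -/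
noncomputable def matA (K : ℕ) : Matrix (Fin (K + 1)) (Fin (K + 1)) ℝ :=
  fun i j =>
    if (j : ℕ) < K then (if i = j then 1 else 0)
    else if (i : ℕ) < K then 1 / (K : ℝ) else Real.sqrt (((K : ℝ) - 1) / K)

open Matrix in
/-- The Gram matrix `AᵀA` differs from the identity by a matrix of rank two. -/
theorem matA_gram_sub_one (K : ℕ) (hK : 1 ≤ K) :
    (matA K)ᵀ * matA K - scalar (Fin (K + 1)) 1 =
      (of fun i => ![(Fin.snoc (fun _ => 1 / (K : ℝ)) 0 : Fin (K + 1) → ℝ) i,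
        (Fin.snoc 0 1 : Fin (K + 1) → ℝ) i]) *
      (of ![(Fin.snoc 0 1 : Fin (K + 1) → ℝ), Fin.snoc (fun _ => 1 / (K : ℝ)) 0]) := by
  have hK' : (1 : ℝ) ≤ K := by exact_mod_cast hK
  have hsqrt : √(((K : ℝ) - 1) / K) * √(((K : ℝ) - 1) / K) = ((K : ℝ) - 1) / K :=
    Real.mul_self_sqrt (div_nonneg (by linarith) (by linarith))
  ext i j
  refine Fin.lastCases ?_ (fun i => ?_) i <;> refine Fin.lastCases ?_ (fun j => ?_) j
  · simp [matA, Matrix.mul_apply, Fin.sum_univ_castSucc, hsqrt, -Real.sqrt_div']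
    field_simp
    ring
  all_goals
    simp [matA, Matrix.mul_apply, Fin.sum_univ_castSucc, one_apply, (Fin.castSucc_lt_last _).ne,
      (Fin.castSucc_lt_last _).ne']
  simp [eq_comm]

open Matrix in
theorem charpoly_matA_gram (K : ℕ) (hK : 1 ≤ K) :
    ((matA K)ᵀ * matA K).charpoly =
      (X - C 1) ^ (K - 1) * (X - C (1 - 1 / √K)) * (X - C (1 + 1 / √K)) := by
  have hK' : (0 : ℝ) < K := by exact_mod_cast hK
  have hsqrt : 1 / √(K : ℝ) * (1 / √K) = 1 / K := by
    rw [div_mul_div_comm, Real.mul_self_sqrt hK'.le, one_mul]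
  have hshift : ((matA K)ᵀ * matA K).charpoly.comp (X + C 1) =
      X ^ (K - 1) * (X ^ 2 - C (1 / (K : ℝ))) := by
    rw [← charpoly_sub_scalar, matA_gram_sub_one K hK,
      charpoly_mul_comm_of_le _ _ (by simpa using hK), charpoly_fin_two]
    have hsum : (K : ℝ) * ((K : ℝ)⁻¹ * (K : ℝ)⁻¹) = (K : ℝ)⁻¹ := by field_simp
    simp [det_fin_two, trace_fin_two, vecMul, dotProduct, Fin.sum_univ_castSucc, hsum, sub_eq_add_neg]
  have hback := congrArg (fun p : ℝ[X] => p.comp (X - C 1)) hshift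
  simp only [comp_assoc, add_comp, X_comp, C_comp, sub_add_cancel, comp_X, mul_comp, pow_comp,
    sub_comp] at hback
  rw [hback, ← hsqrt]
  simp only [C_add, C_sub, C_mul]
  ring

/-- the characteristic polynomial of `AᵀA` is
`(λ - 1)^{K-1} (λ - (1 - 1/√K)) (λ - (1 + 1/√K))`; in particular its eigenvalues are `1`
(with multiplicity `K-1`), `1 - 1/√K` and `1 + 1/√K`. -/
theorem stmt6 (K : ℕ) (hK : 2 ≤ K) :
    ((matA K).transpose * matA K).charpoly =
        (X - C 1) ^ (K - 1) * (X - C (1 - 1 / Real.sqrt K)) * (X - C (1 + 1 / Real.sqrt K)) ∧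
      Module.End.HasEigenvalue (Matrix.toLin' ((matA K).transpose * matA K)) 1 ∧
      Module.End.HasEigenvalue (Matrix.toLin' ((matA K).transpose * matA K)) (1 - 1 / Real.sqrt K) ∧
      Module.End.HasEigenvalue (Matrix.toLin' ((matA K).transpose * matA K)) (1 + 1 / Real.sqrt K) := by
  have hchar := charpoly_matA_gram K (by omega)
  refine ⟨hchar, ?_, ?_, ?_⟩ <;>
    rw [Module.End.hasEigenvalue_iff_isRoot_charpoly, Matrix.charpoly_toLin', hchar]
  · have hne : K - 1 ≠ 0 := by omega
    simp [hne]
  · simp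
  · simp
end

section
/- Let K ≥ 2 be an integer and let A be the (K+1) × (K+1) real matrix whose first K columns are the first K standard basis vectors of ℝ^{K+1} and whose last column has entries 1/K in the first K coordinates and √((K−1)/K) in the last coordinate. Then for every x ∈ ℝ^{K+1}, (1 − 1/√K) ‖x‖₂² ≤ ‖A x‖₂² ≤ (1 + 1/√K) ‖x‖₂²; in particular A satisfies the restricted isometry property of order K+1 with constant 1/√K. -/
open scoped BigOperators

theorem matA_mulVec_castSucc (K : ℕ) (x : Fin (K + 1) → ℝ) (i : Fin K) :
    (matA K).mulVec x i.castSucc = x i.castSucc + x (Fin.last K) / K := by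
  simp [Matrix.mulVec, dotProduct, Fin.sum_univ_castSucc, matA]
  ring

theorem matA_mulVec_last (K : ℕ) (x : Fin (K + 1) → ℝ) :
    (matA K).mulVec x (Fin.last K) = √(((K : ℝ) - 1) / K) * x (Fin.last K) := by
  simp [Matrix.mulVec, dotProduct, Fin.sum_univ_castSucc, matA, (Fin.castSucc_ne_last _).symm]

/-- The quadratic form of `AᵀA` differs from the identity by a cross term only. -/
theorem sum_sq_matA_mulVec {K : ℕ} (hK : 1 ≤ K) (x : Fin (K + 1) → ℝ) :
    ∑ j, (matA K).mulVec x j ^ 2 =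
      ∑ i, x i ^ 2 + 2 * x (Fin.last K) * (∑ i : Fin K, x i.castSucc) / K := by
  have hK' : (1 : ℝ) ≤ K := by exact_mod_cast hK
  have hpos : (0 : ℝ) < K := by linarith
  have hsqrt : √(((K : ℝ) - 1) / K) ^ 2 = ((K : ℝ) - 1) / K :=
    Real.sq_sqrt (div_nonneg (by linarith) hpos.le)
  simp only [Fin.sum_univ_castSucc, matA_mulVec_castSucc, matA_mulVec_last, mul_pow, hsqrt,
    add_sq, Finset.sum_add_distrib, ← Finset.sum_mul, ← Finset.mul_sum, Finset.sum_const,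
    Finset.card_univ, Fintype.card_fin, nsmul_eq_mul]
  field_simp
  ring

theorem abs_cross_term_le {K : ℕ} (hK : 1 ≤ K) (x : Fin (K + 1) → ℝ) :
    |2 * x (Fin.last K) * (∑ i : Fin K, x i.castSucc) / K| ≤ 1 / √K * ∑ i, x i ^ 2 := by
  have hpos : (0 : ℝ) < K := by exact_mod_cast hK
  have hr : 0 < √(K : ℝ) := Real.sqrt_pos.2 hpos
  have hsq : √(K : ℝ) ^ 2 = K := Real.sq_sqrt hpos.le
  rw [Fin.sum_univ_castSucc]
  set t := x (Fin.last K)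
  set S := ∑ i : Fin K, x i.castSucc
  have hS : (S / √K) ^ 2 ≤ ∑ i : Fin K, x i.castSucc ^ 2 := by
    rw [div_pow, hsq, div_le_iff₀ hpos, mul_comm]
    simpa using sq_sum_le_card_mul_sum_sq (s := Finset.univ) (f := fun i : Fin K => x i.castSucc)
  have hsplit : 2 * t * S / K = 1 / √K * (2 * t * (S / √K)) := by
    field_simp
    rw [hsq]
  rw [hsplit, abs_mul, abs_of_pos (by positivity : 0 < 1 / √(K : ℝ))]
  refine mul_le_mul_of_nonneg_left (abs_le.2 ⟨?_, ?_⟩) (by positivity)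
  · nlinarith [sq_nonneg (t + S / √K)]
  · nlinarith [sq_nonneg (t - S / √K)]

/-- for every `x ∈ ℝ^{K+1}`,
`(1 - 1/√K)‖x‖₂² ≤ ‖A x‖₂² ≤ (1 + 1/√K)‖x‖₂²`; in particular `A` satisfies the restricted
isometry property of order `K+1` with constant `1/√K`. -/
theorem stmt7 (K : ℕ) (hK : 2 ≤ K) :
    (∀ x : Fin (K + 1) → ℝ,
        (1 - 1 / Real.sqrt K) * (∑ i, x i ^ 2) ≤ ∑ j, ((matA K).mulVec x) j ^ 2 ∧
          ∑ j, ((matA K).mulVec x) j ^ 2 ≤ (1 + 1 / Real.sqrt K) * (∑ i, x i ^ 2)) ∧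
      RIP (matA K) (K + 1) (1 / Real.sqrt K) := by
  have bounds (x : Fin (K + 1) → ℝ) :
      (1 - 1 / Real.sqrt K) * (∑ i, x i ^ 2) ≤ ∑ j, ((matA K).mulVec x) j ^ 2 ∧
        ∑ j, ((matA K).mulVec x) j ^ 2 ≤ (1 + 1 / Real.sqrt K) * (∑ i, x i ^ 2) := by
    have hK1 : 1 ≤ K := by omega
    obtain ⟨hlower, hupper⟩ := abs_le.1 (abs_cross_term_le hK1 x)
    rw [sum_sq_matA_mulVec hK1]
    constructor <;> linarith
  exact ⟨bounds, fun x _ => bounds x⟩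
end

section
/- Let K ≥ 2 be an integer, let A be the (K+1) × (K+1) real matrix whose first K columns are the first K standard basis vectors of ℝ^{K+1} and whose last column has entries 1/K in the first K coordinates and √((K−1)/K) in the last coordinate, and let x = (1, 1, …, 1, 0)ᵀ ∈ ℝ^{K+1} (ones in the first K coordinates, zero in the last). Then ⟨A e_i, A x⟩ = 1 for every i ∈ {1, …, K+1}. In particular, the maximum of i ↦ |⟨A e_i, A x⟩| over all i is attained at the index K+1, which lies outside the support of x, so the first greedy selection of Orthogonal Matching Pursuit applied to (A, Ax) can choose an index not in the support of x. -/
open scoped BigOperators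

/-- The vector `(1, …, 1, 0)ᵀ` is fixed by `matA K`. -/
theorem matA_mulVec_ones (K : ℕ) :
    (matA K).mulVec (fun i : Fin (K + 1) => if (i : ℕ) < K then (1 : ℝ) else 0) =
      fun i : Fin (K + 1) => if (i : ℕ) < K then (1 : ℝ) else 0 := by
  funext i
  induction i using Fin.lastCases with
  | last =>
    simp [Matrix.mulVec, dotProduct, Fin.sum_univ_castSucc, matA, (Fin.castSucc_ne_last _).symm]
  | cast i => simp [Matrix.mulVec, dotProduct, Fin.sum_univ_castSucc, matA]

/-- Every column of `matA K` has inner product `1` with `(1, …, 1, 0)ᵀ`. -/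
theorem dotp_matA_col_ones (K : ℕ) (hK : K ≠ 0) (i : Fin (K + 1)) :
    dotp ((matA K).mulVec (Pi.single i 1))
      (fun i : Fin (K + 1) => if (i : ℕ) < K then (1 : ℝ) else 0) = 1 := by
  have hK' : (K : ℝ) ≠ 0 := Nat.cast_ne_zero.mpr hK
  induction i using Fin.lastCases with
  | last => simp [dotp, Fin.sum_univ_castSucc, matA, hK']
  | cast i => simp [dotp, Fin.sum_univ_castSucc, matA]

/-- for `x = (1, …, 1, 0)ᵀ` one has `⟨A e_i, A x⟩ = 1` for all `i`; in
particular the maximum of `i ↦ |⟨A e_i, A x⟩|` is attained at the index `K+1`, which lies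
outside the support of `x`, so the first greedy selection of OMP applied to `(A, Ax)` can
choose an index not in the support of `x`. -/
theorem stmt9 (K : ℕ) (hK : 2 ≤ K)
    (x : Fin (K + 1) → ℝ) (hx : x = fun i : Fin (K + 1) => if (i : ℕ) < K then (1:ℝ) else 0) :
    (∀ i : Fin (K + 1),
        dotp ((matA K).mulVec (Pi.single i 1)) ((matA K).mulVec x) = 1) ∧
      (∀ i : Fin (K + 1),
        |dotp ((matA K).mulVec (Pi.single i 1)) ((matA K).mulVec x)| ≤
          |dotp ((matA K).mulVec (Pi.single (Fin.last K) 1)) ((matA K).mulVec x)|) ∧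
      x (Fin.last K) = 0 := by
  subst hx
  have h (i : Fin (K + 1)) := dotp_matA_col_ones K (by omega) i
  rw [matA_mulVec_ones]
  exact ⟨h, fun i => by rw [h, h], by simp⟩
end
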